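/- Let λ < 0 and let b_n > 0 solve π|λ|(1+λ²) b_n² exp((1+λ²)b_n²/2) = n, with a_n = ((1+λ²)b_n)^{-1}. Then there exist constants C'_λ, C''_λ > 0 and n_0(λ) such that for all n ≥ n_0(λ), C'_λ/log n < sup_{x∈ℝ} |F_λ^n(a_n x + b_n) - exp(-e^{-x})| < C''_λ/log n. -/

import Mathlib

open Real MeasureTheory Filter

noncomputable def stdPhi (x : ℝ) : ℝ := (Real.sqrt (2 * Real.pi))⁻¹ * Real.exp (-x ^ 2 / 2)

noncomputable def stdCdf (x : ℝ) : ℝ := ∫ t in Set.Iic x, stdPhi t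

noncomputable def snCdf (l x : ℝ) : ℝ := ∫ t in Set.Iic x, 2 * stdPhi t * stdCdf (l * t)

theorem stdPhi_eq_gaussianPDFReal : stdPhi = ProbabilityTheory.gaussianPDFReal 0 1 := by
  funext x
  simp [stdPhi, ProbabilityTheory.gaussianPDFReal]

theorem stdPhi_pos (x : ℝ) : 0 < stdPhi x := by
  unfold stdPhi; positivity

theorem integrable_stdPhi : Integrable stdPhi := by
  rw [stdPhi_eq_gaussianPDFReal]
  exact ProbabilityTheory.integrable_gaussianPDFReal 0 1

theorem integral_stdPhi : ∫ t, stdPhi t = 1 := by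
  rw [stdPhi_eq_gaussianPDFReal]
  exact ProbabilityTheory.integral_gaussianPDFReal_eq_one 0 one_ne_zero

theorem stdPhi_neg (x : ℝ) : stdPhi (-x) = stdPhi x := by
  simp [stdPhi]

theorem stdCdf_neg (x : ℝ) : stdCdf (-x) = ∫ t in Set.Ioi x, stdPhi t := by
  have h := integral_comp_neg_Iic (-x) stdPhi
  simp only [stdPhi_neg, neg_neg] at h
  exact h

theorem stdCdf_add_stdCdf_neg (x : ℝ) : stdCdf x + stdCdf (-x) = 1 := by
  rw [stdCdf_neg, stdCdf, intervalIntegral.integral_Iic_add_Ioi integrable_stdPhi.integrableOn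
    integrable_stdPhi.integrableOn, integral_stdPhi]

theorem stdCdf_nonneg (x : ℝ) : 0 ≤ stdCdf x :=
  integral_nonneg fun t => (stdPhi_pos t).le

theorem stdCdf_le_one (x : ℝ) : stdCdf x ≤ 1 := by
  linarith [stdCdf_add_stdCdf_neg x, stdCdf_nonneg (-x)]

theorem monotone_stdCdf : Monotone stdCdf := fun _ _ h =>
  setIntegral_mono_set integrable_stdPhi.integrableOn
    (Eventually.of_forall fun t => (stdPhi_pos t).le) (Set.Iic_subset_Iic.2 h).eventuallyLE

/-- The density of the skew-normal distribution. -/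
noncomputable def snPdf (l t : ℝ) : ℝ := 2 * stdPhi t * stdCdf (l * t)

/-- The upper tail of the skew-normal distribution. -/
noncomputable def snTail (l x : ℝ) : ℝ := ∫ t in Set.Ioi x, snPdf l t

theorem snPdf_nonneg (l t : ℝ) : 0 ≤ snPdf l t :=
  mul_nonneg (mul_nonneg zero_le_two (stdPhi_pos t).le) (stdCdf_nonneg _)

theorem integrable_snPdf (l : ℝ) : Integrable (snPdf l) := by
  refine (integrable_stdPhi.const_mul 2).mono' ?_ (Eventually.of_forall fun t => ?_)
  · exact ((integrable_stdPhi.const_mul 2).aestronglyMeasurable).mul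
      (monotone_stdCdf.measurable.comp (measurable_const_mul l)).aestronglyMeasurable
  · rw [Real.norm_of_nonneg (snPdf_nonneg l t)]
    exact mul_le_of_le_one_right (mul_nonneg zero_le_two (stdPhi_pos t).le) (stdCdf_le_one _)

theorem integral_snPdf (l : ℝ) : ∫ t, snPdf l t = 1 := by
  have h1 : ∫ t, snPdf l (-t) = ∫ t, snPdf l t := integral_neg_eq_self (snPdf l) volume
  have h2 : ∫ t, (snPdf l t + snPdf l (-t)) = ∫ t, 2 * stdPhi t := by
    congr 1
    funext t
    have := stdCdf_add_stdCdf_neg (l * t)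
    simp only [snPdf, stdPhi_neg, mul_neg]
    linear_combination 2 * stdPhi t * this
  rw [integral_add (integrable_snPdf l) (integrable_snPdf l).comp_neg, h1,
    integral_const_mul, integral_stdPhi] at h2
  linarith

theorem snCdf_eq (l x : ℝ) : snCdf l x = 1 - snTail l x := by
  have h := intervalIntegral.integral_Iic_add_Ioi (b := x) (integrable_snPdf l).integrableOn
    (integrable_snPdf l).integrableOn
  rw [integral_snPdf] at h
  exact eq_sub_of_add_eq h

theorem snTail_nonneg (l x : ℝ) : 0 ≤ snTail l x :=
  integral_nonneg fun t => snPdf_nonneg l t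

theorem snTail_le_one (l x : ℝ) : snTail l x ≤ 1 := by
  have : 0 ≤ snCdf l x := integral_nonneg fun t => snPdf_nonneg l t
  linarith [snCdf_eq l x]

theorem antitone_snTail (l : ℝ) : Antitone (snTail l) := fun _ _ h =>
  setIntegral_mono_set (integrable_snPdf l).integrableOn
    (Eventually.of_forall fun t => snPdf_nonneg l t) (Set.Ioi_subset_Ioi h).eventuallyLE

/-- If `-G' ≤ g` on `(x, ∞)` and `G` vanishes at infinity, then `G x ≤ ∫_x^∞ g`. -/
theorem le_integral_Ioi_of_hasDerivAt {g G G' : ℝ → ℝ} {x : ℝ} (hg : IntegrableOn g (Set.Ici x))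
    (hG : ∀ t, x ≤ t → HasDerivAt G (G' t) t) (hlim : Tendsto G atTop (nhds 0))
    (h : ∀ t, x < t → -G' t ≤ g t) : G x ≤ ∫ t in Set.Ioi x, g t := by
  have h1 : Tendsto (fun N => ∫ t in x..N, g t) atTop (nhds (∫ t in Set.Ioi x, g t)) :=
    intervalIntegral_tendsto_integral_Ioi x (hg.mono_set Set.Ioi_subset_Ici_self) tendsto_id
  have h2 : Tendsto (fun N => G x - G N) atTop (nhds (G x - 0)) := hlim.const_sub _
  rw [sub_zero] at h2
  refine le_of_tendsto_of_tendsto h2 h1 ?_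
  filter_upwards [eventually_ge_atTop x] with N hN
  have := intervalIntegral.sub_le_integral_of_hasDeriv_right_of_le (g := fun t => -G t)
    (g' := fun t => -G' t) hN
    (fun t ht => ((hG t ht.1).neg).continuousAt.continuousWithinAt)
    (fun t ht => ((hG t ht.1.le).neg).hasDerivWithinAt) (hg.mono_set Set.Icc_subset_Ici_self)
    (fun t ht => h t ht.1)
  linarith

theorem integral_Ioi_le_of_hasDerivAt {g G G' : ℝ → ℝ} {x : ℝ} (hg : IntegrableOn g (Set.Ici x))
    (hG : ∀ t, x ≤ t → HasDerivAt G (G' t) t) (hlim : Tendsto G atTop (nhds 0))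
    (h : ∀ t, x < t → g t ≤ -G' t) : ∫ t in Set.Ioi x, g t ≤ G x := by
  have := le_integral_Ioi_of_hasDerivAt (G := fun t => -G t) (G' := fun t => -G' t) hg.neg
    (fun t ht => (hG t ht).neg) (by simpa using hlim.neg) (fun t ht => by
      simpa using neg_le_neg (h t ht))
  simp only [Pi.neg_apply, integral_neg] at this
  linarith

theorem hasDerivAt_stdPhi (t : ℝ) : HasDerivAt stdPhi (-t * stdPhi t) t := by
  have h1 : HasDerivAt (fun s : ℝ => -s ^ 2 / 2) (-t) t := by
    refine ((hasDerivAt_pow 2 t).neg.div_const 2).congr_deriv ?_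
    simp
    ring
  exact (h1.exp.const_mul _).congr_deriv (by unfold stdPhi; ring)

theorem tendsto_exp_neg_mul_sq_atTop {c : ℝ} (hc : 0 < c) :
    Tendsto (fun t : ℝ => rexp (-c * t ^ 2 / 2)) atTop (nhds 0) := by
  refine tendsto_exp_atBot.comp ?_
  have : Tendsto (fun t : ℝ => (-c / 2) * t ^ 2) atTop atBot :=
    (tendsto_pow_atTop two_ne_zero).const_mul_atTop_of_neg (by linarith)
  exact this.congr fun t => by ring

theorem tendsto_stdPhi_atTop : Tendsto stdPhi atTop (nhds 0) := by
  have h := (tendsto_exp_neg_mul_sq_atTop one_pos).const_mul (√(2 * π))⁻¹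
  rw [mul_zero] at h
  exact h.congr fun t => by rw [stdPhi, neg_one_mul]

/-- Mills' upper bound for the Gaussian tail. -/
theorem stdCdf_neg_le {y : ℝ} (hy : 0 < y) : stdCdf (-y) ≤ stdPhi y / y := by
  rw [stdCdf_neg]
  refine integral_Ioi_le_of_hasDerivAt (G := fun t => stdPhi t / t)
    integrable_stdPhi.integrableOn
    (fun t ht => (hasDerivAt_stdPhi t).div (hasDerivAt_id t) (hy.trans_le ht).ne')
    (tendsto_stdPhi_atTop.div_atTop tendsto_id) (fun t ht => ?_)
  have ht0 : 0 < t := hy.trans ht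
  have : -((-t * stdPhi t * t - stdPhi t * 1) / t ^ 2) = stdPhi t + stdPhi t / t ^ 2 := by
    field_simp
    ring
  rw [this]
  have := stdPhi_pos t
  have : 0 ≤ stdPhi t / t ^ 2 := by positivity
  linarith

/-- Mills' lower bound for the Gaussian tail. -/
theorem le_stdCdf_neg {y : ℝ} (hy : 0 < y) : stdPhi y / y * (1 - 1 / y ^ 2) ≤ stdCdf (-y) := by
  rw [stdCdf_neg]
  have hlim : Tendsto (fun t : ℝ => stdPhi t / t * (1 - 1 / t ^ 2)) atTop (nhds 0) := by
    simpa using (tendsto_stdPhi_atTop.div_atTop tendsto_id).mul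
      ((tendsto_const_nhds (x := (1 : ℝ)).div_atTop
        (tendsto_pow_atTop (α := ℝ) two_ne_zero)).const_sub 1)
  refine le_integral_Ioi_of_hasDerivAt (G := fun t => stdPhi t / t * (1 - 1 / t ^ 2))
    (G' := fun t => -(stdPhi t * (1 - 3 / t ^ 4)))
    integrable_stdPhi.integrableOn (fun t ht => ?_) hlim (fun t ht => ?_)
  · have ht0 : t ≠ 0 := (hy.trans_le ht).ne'
    refine (((hasDerivAt_stdPhi t).div (hasDerivAt_id t) ht0).mul
      (((hasDerivAt_const t (1 : ℝ)).div ((hasDerivAt_id t).pow 2)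
        (pow_ne_zero 2 ht0)).const_sub 1)).congr_deriv ?_
    simp only [id, Nat.cast_ofNat]
    simp
    field_simp
    ring
  · have ht0 : 0 < t := hy.trans ht
    have h1 := stdPhi_pos t
    have h2 : 0 ≤ 3 / t ^ 4 := by positivity
    nlinarith

/-- The leading term `exp(-(1+l²)x²/2) / (π|l|(1+l²)x²)` of the skew-normal tail. -/
noncomputable def snTailLead (l x : ℝ) : ℝ :=
  rexp (-(1 + l ^ 2) * x ^ 2 / 2) / (π * |l| * (1 + l ^ 2) * x ^ 2)

theorem stdPhi_mul_stdPhi (l t : ℝ) :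
    stdPhi t * stdPhi (|l| * t) = rexp (-(1 + l ^ 2) * t ^ 2 / 2) / (2 * π) := by
  have h : (√(2 * π))⁻¹ * (√(2 * π))⁻¹ = (2 * π)⁻¹ := by
    rw [← mul_inv, Real.mul_self_sqrt (by positivity)]
  have h2 : rexp (-t ^ 2 / 2) * rexp (-(|l| * t) ^ 2 / 2) = rexp (-(1 + l ^ 2) * t ^ 2 / 2) := by
    rw [← Real.exp_add, mul_pow, sq_abs]
    congr 1
    ring
  unfold stdPhi
  rw [← h2, div_eq_mul_inv (_ * _) (2 * π), ← h]
  ring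

theorem snPdf_le {l : ℝ} (hl : l < 0) {t : ℝ} (ht : 0 < t) :
    snPdf l t ≤ rexp (-(1 + l ^ 2) * t ^ 2 / 2) / (π * |l| * t) := by
  have hm : 0 < |l| := abs_pos.2 hl.ne
  have h1 := stdCdf_neg_le (mul_pos hm ht)
  have h2 : l * t = -(|l| * t) := by rw [abs_of_neg hl]; ring
  have h3 := mul_le_mul_of_nonneg_left h1 (mul_nonneg zero_le_two (stdPhi_pos t).le)
  rw [snPdf, h2]
  refine h3.trans_eq ?_
  rw [mul_assoc, ← mul_div_assoc, stdPhi_mul_stdPhi]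
  field_simp

theorem le_snPdf {l : ℝ} (hl : l < 0) {t : ℝ} (ht : 0 < t) :
    rexp (-(1 + l ^ 2) * t ^ 2 / 2) / (π * |l| * t) * (1 - 1 / (l ^ 2 * t ^ 2)) ≤ snPdf l t := by
  have hm : 0 < |l| := abs_pos.2 hl.ne
  have h1 := le_stdCdf_neg (mul_pos hm ht)
  have h2 : l * t = -(|l| * t) := by rw [abs_of_neg hl]; ring
  have h3 := mul_le_mul_of_nonneg_left h1 (mul_nonneg zero_le_two (stdPhi_pos t).le)
  rw [snPdf, h2]
  refine (Eq.trans_le ?_ h3)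
  rw [mul_pow, sq_abs, ← mul_assoc, mul_assoc 2, ← mul_div_assoc, stdPhi_mul_stdPhi]
  field_simp

theorem hasDerivAt_snTailLead_mul {l : ℝ} (hl : l < 0) (k : ℝ) {t : ℝ} (ht : 0 < t) :
    HasDerivAt (fun t => snTailLead l t * (1 - k / t ^ 2))
      (-(rexp (-(1 + l ^ 2) * t ^ 2 / 2) / (π * |l| * t) *
        (1 + (2 / (1 + l ^ 2) - k) / t ^ 2 - 4 * k / ((1 + l ^ 2) * t ^ 4)))) t := by
  have hm : 0 < |l| := abs_pos.2 hl.ne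
  have hc : 0 < 1 + l ^ 2 := by positivity
  have hsq : HasDerivAt (fun s : ℝ => s ^ 2) (2 * t) t := by simpa using hasDerivAt_pow 2 t
  have hE : HasDerivAt (fun s : ℝ => rexp (-(1 + l ^ 2) * s ^ 2 / 2))
      (rexp (-(1 + l ^ 2) * t ^ 2 / 2) * (-(1 + l ^ 2) * (2 * t) / 2)) t :=
    ((hsq.const_mul _).div_const 2).exp
  have hd : π * |l| * (1 + l ^ 2) * t ^ 2 ≠ 0 := by positivity
  refine ((hE.div (hsq.const_mul (π * |l| * (1 + l ^ 2))) hd).mul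
    (((hasDerivAt_const t k).div hsq (by positivity)).const_sub 1)).congr_deriv ?_
  simp only [Pi.div_apply]
  field_simp
  ring

theorem tendsto_snTailLead_mul {l : ℝ} (hl : l < 0) (k : ℝ) :
    Tendsto (fun t => snTailLead l t * (1 - k / t ^ 2)) atTop (nhds 0) := by
  have hm : 0 < |l| := abs_pos.2 hl.ne
  have hc : 0 < 1 + l ^ 2 := by positivity
  have hp : Tendsto (fun t : ℝ => t ^ 2) atTop atTop := tendsto_pow_atTop two_ne_zero
  have h1 : Tendsto (snTailLead l) atTop (nhds 0) :=
    (tendsto_exp_neg_mul_sq_atTop hc).div_atTop (hp.const_mul_atTop (by positivity))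
  simpa using h1.mul ((tendsto_const_nhds (x := k).div_atTop hp).const_sub 1)

theorem snTail_le {l : ℝ} (hl : l < 0) {x : ℝ} (hx : 0 < x) (hx2 : 4 ≤ (1 + l ^ 2) * x ^ 2) :
    snTail l x ≤ snTailLead l x * (1 - 1 / (1 + l ^ 2) / x ^ 2) := by
  refine integral_Ioi_le_of_hasDerivAt (integrable_snPdf l).integrableOn
    (fun t ht => hasDerivAt_snTailLead_mul hl _ (hx.trans_le ht))
    (tendsto_snTailLead_mul hl _) (fun t ht => ?_)
  have ht0 : 0 < t := hx.trans ht
  have hm : 0 < |l| := abs_pos.2 hl.ne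
  have hc : 0 < 1 + l ^ 2 := by positivity
  rw [neg_neg]
  refine (snPdf_le hl ht0).trans (le_mul_of_one_le_right (by positivity) ?_)
  have h4 : 4 ≤ (1 + l ^ 2) * t ^ 2 :=
    hx2.trans (mul_le_mul_of_nonneg_left (by gcongr) hc.le)
  have : (2 / (1 + l ^ 2) - 1 / (1 + l ^ 2)) / t ^ 2 - 4 * (1 / (1 + l ^ 2)) / ((1 + l ^ 2) * t ^ 4)
      = ((1 + l ^ 2) * t ^ 2 - 4) / ((1 + l ^ 2) ^ 2 * t ^ 4) := by
    field_simp
    ring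
  have h5 : 0 ≤ ((1 + l ^ 2) * t ^ 2 - 4) / ((1 + l ^ 2) ^ 2 * t ^ 4) :=
    div_nonneg (by linarith) (by positivity)
  linarith

theorem le_snTail {l : ℝ} (hl : l < 0) {x : ℝ} (hx : 0 < x) :
    snTailLead l x * (1 - (2 / (1 + l ^ 2) + 1 / l ^ 2) / x ^ 2) ≤ snTail l x := by
  refine le_integral_Ioi_of_hasDerivAt (integrable_snPdf l).integrableOn
    (fun t ht => hasDerivAt_snTailLead_mul hl _ (hx.trans_le ht))
    (tendsto_snTailLead_mul hl _) (fun t ht => ?_)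
  have ht0 : 0 < t := hx.trans ht
  have hm : 0 < |l| := abs_pos.2 hl.ne
  have hl0 : l ≠ 0 := hl.ne
  rw [neg_neg]
  refine le_trans (mul_le_mul_of_nonneg_left ?_ (by positivity)) (le_snPdf hl ht0)
  have h1 : (2 / (1 + l ^ 2) - (2 / (1 + l ^ 2) + 1 / l ^ 2)) / t ^ 2 = -(1 / (l ^ 2 * t ^ 2)) := by
    field_simp
    ring
  have h2 : 0 ≤ 4 * (2 / (1 + l ^ 2) + 1 / l ^ 2) / ((1 + l ^ 2) * t ^ 4) := by positivity
  linarith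

theorem abs_exp_neg_sub_exp_neg_le {p q w : ℝ} (hp : w ≤ p) (hq : w ≤ q) :
    |rexp (-p) - rexp (-q)| ≤ rexp (-w) * |p - q| := by
  wlog h : p ≤ q generalizing p q
  · rw [abs_sub_comm, abs_sub_comm p]
    exact this hq hp (le_of_not_ge h)
  rw [abs_of_nonneg (sub_nonneg.2 (Real.exp_le_exp.2 (neg_le_neg h))), abs_sub_comm,
    abs_of_nonneg (sub_nonneg.2 h)]
  have h1 : rexp (-q) = rexp (-p) * rexp (p - q) := by rw [← Real.exp_add]; congr 1; ring
  have h2 := Real.add_one_le_exp (p - q)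
  calc rexp (-p) - rexp (-q) = rexp (-p) * (1 - rexp (p - q)) := by rw [h1]; ring
    _ ≤ rexp (-p) * (q - p) :=
      mul_le_mul_of_nonneg_left (by linarith) (Real.exp_pos _).le
    _ ≤ rexp (-w) * (q - p) :=
      mul_le_mul_of_nonneg_right (Real.exp_le_exp.2 (neg_le_neg hp)) (sub_nonneg.2 h)

theorem mul_exp_neg_le_one (z : ℝ) : z * rexp (-z) ≤ 1 := by
  have h := Real.add_one_le_exp z
  rw [Real.exp_neg, ← div_eq_mul_inv, div_le_one (Real.exp_pos z)]
  linarith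

theorem sq_mul_exp_neg_le_two {z : ℝ} (hz : 0 ≤ z) : z ^ 2 * rexp (-z) ≤ 2 := by
  have h := Real.quadratic_le_exp_of_nonneg hz
  rw [Real.exp_neg, ← div_eq_mul_inv, div_le_iff₀ (Real.exp_pos z)]
  linarith

/-- The Poisson approximation `(1 - T)ⁿ ≈ exp(-nT)`, uniformly in `T ∈ [0, 1]`. -/
theorem abs_one_sub_pow_sub_exp_le {T : ℝ} (h0 : 0 ≤ T) (h1 : T ≤ 1) {n : ℕ} (hn : 1 ≤ n) :
    |(1 - T) ^ n - rexp (-(n * T))| ≤ 6 / n := by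
  have hn0 : (0 : ℝ) < n := by exact_mod_cast hn
  have hle : 1 - T ≤ rexp (-T) := Real.one_sub_le_exp_neg T
  have hpow : rexp (-(n * T)) = rexp (-T) ^ n := by
    rw [← Real.exp_nat_mul]
    congr 1
    ring
  have hA := abs_pow_sub_pow_le (1 - T) (rexp (-T)) n
  rw [abs_of_nonneg (sub_nonneg.2 h1), abs_of_pos (Real.exp_pos _), max_eq_right hle] at hA
  have hB : |1 - T - rexp (-T)| ≤ T ^ 2 := by
    have := Real.abs_exp_sub_one_sub_id_le (x := -T) (by rwa [abs_neg, abs_of_nonneg h0])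
    rw [neg_sq] at this
    rw [abs_sub_comm]
    convert this using 2
    ring
  have hC : rexp (-T) ^ (n - 1) ≤ 3 * rexp (-(n * T)) := by
    have he : rexp (-T) ^ n = rexp (-T) ^ (n - 1) * rexp (-T) := by
      rw [← pow_succ, Nat.sub_add_cancel hn]
    rw [hpow, he]
    have h3 : 1 ≤ 3 * rexp (-T) := by
      have h4 : rexp T ≤ 3 := (Real.exp_le_exp.2 h1).trans Real.exp_one_lt_three.le
      have h5 : rexp T * rexp (-T) = 1 := by rw [← Real.exp_add]; simp
      rw [← h5]
      gcongr
    have := pow_nonneg (Real.exp_pos (-T)).le (n - 1)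
    nlinarith
  have hD := sq_mul_exp_neg_le_two (mul_nonneg hn0.le h0)
  rw [hpow]
  calc |(1 - T) ^ n - rexp (-T) ^ n|
      ≤ |1 - T - rexp (-T)| * n * rexp (-T) ^ (n - 1) := hA
    _ ≤ T ^ 2 * n * (3 * rexp (-(n * T))) := by gcongr
    _ = 3 * ((n * T) ^ 2 * rexp (-(n * T))) / n := by field_simp
    _ ≤ 3 * 2 / n := by gcongr
    _ = 6 / n := by norm_num

/-- The equation defining the norming constant `b`. -/
def IsNorming (l N b : ℝ) : Prop :=
  0 < b ∧ π * |l| * (1 + l ^ 2) * b ^ 2 * rexp ((1 + l ^ 2) * b ^ 2 / 2) = N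

theorem IsNorming.mul_snTailLead {l N b : ℝ} (h : IsNorming l N b) (hl : l < 0) (x : ℝ) :
    N * snTailLead l (((1 + l ^ 2) * b)⁻¹ * x + b) =
      rexp (-x) * (rexp (-(x ^ 2 / (2 * (1 + l ^ 2) * b ^ 2))) *
        (b / (((1 + l ^ 2) * b)⁻¹ * x + b)) ^ 2) := by
  obtain ⟨hb, rfl⟩ := h
  have hm : 0 < |l| := abs_pos.2 hl.ne
  have hc : 0 < 1 + l ^ 2 := by positivity
  set y := ((1 + l ^ 2) * b)⁻¹ * x + b with hy
  have hE : rexp ((1 + l ^ 2) * b ^ 2 / 2) * rexp (-(1 + l ^ 2) * y ^ 2 / 2) =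
      rexp (-x) * rexp (-(x ^ 2 / (2 * (1 + l ^ 2) * b ^ 2))) := by
    rw [← Real.exp_add, ← Real.exp_add, hy]
    congr 1
    field_simp
    ring
  rw [← mul_assoc, ← hE, snTailLead, div_pow]
  rw [mul_div_assoc', mul_div_assoc', ← mul_div_mul_left _ (y ^ 2)
    (show π * |l| * (1 + l ^ 2) ≠ 0 by positivity)]
  congr 1
  ring

theorem IsNorming.abs_sub_le_of_nonneg {l N b x : ℝ} (h : IsNorming l N b) (hl : l < 0)
    (hb4 : 4 ≤ (1 + l ^ 2) * b ^ 2) (hbK : 2 / (1 + l ^ 2) + 1 / l ^ 2 ≤ b ^ 2) (hx : 0 ≤ x) :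
    |rexp (-(N * snTail l (((1 + l ^ 2) * b)⁻¹ * x + b))) - rexp (-rexp (-x))| ≤
      (3 / (1 + l ^ 2) + (2 / (1 + l ^ 2) + 1 / l ^ 2)) / b ^ 2 := by
  have hlead := h.mul_snTailLead hl x
  have hN : 0 ≤ N := by rw [← h.2]; positivity
  have hb := h.1
  have hl0 : l ≠ 0 := hl.ne
  have hc : 0 < 1 + l ^ 2 := by positivity
  set c := 1 + l ^ 2
  set K := 2 / c + 1 / l ^ 2 with hK
  have hK0 : 0 < K := by positivity
  have hax : 0 ≤ (c * b)⁻¹ * x := by positivity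
  set y := (c * b)⁻¹ * x + b with hy
  have hyb : b ≤ y := by linarith
  have hy0 : 0 < y := hb.trans_le hyb
  have hyb2 : b ^ 2 ≤ y ^ 2 := by gcongr
  set E := rexp (-(x ^ 2 / (2 * c * b ^ 2))) with hE
  have hE1 : E ≤ 1 := Real.exp_le_one_iff.2 (neg_nonpos.2 (by positivity))
  have hE2 : 1 - x ^ 2 / (2 * c * b ^ 2) ≤ E := Real.one_sub_le_exp_neg _
  set R := (b / y) ^ 2 with hR
  have hby1 : b / y ≤ 1 := (div_le_one hy0).2 hyb
  have hR1 : R ≤ 1 := pow_le_one₀ (by positivity) hby1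
  have hR2 : 1 - 2 * (x / (c * b ^ 2)) ≤ R := by
    have h1 : 1 - x / (c * b ^ 2) ≤ b / y := by
      rw [le_div_iff₀ hy0, hy]
      have : (1 - x / (c * b ^ 2)) * ((c * b)⁻¹ * x + b) = b - b * (x / (c * b ^ 2)) ^ 2 := by
        field_simp
        ring
      rw [this]
      have : 0 ≤ b * (x / (c * b ^ 2)) ^ 2 := by positivity
      linarith
    rw [hR]
    nlinarith [sq_nonneg (1 - b / y)]
  have hE0 : 0 ≤ E := (Real.exp_pos _).le
  have hR0 : 0 ≤ R := by positivity
  have hKy : K / y ^ 2 ≤ K / b ^ 2 := by gcongr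
  have hKb : K / b ^ 2 ≤ 1 := (div_le_one (by positivity)).2 hbK
  have hlow := mul_le_mul_of_nonneg_left (le_snTail hl hy0) hN
  have hup := mul_le_mul_of_nonneg_left
    (snTail_le hl hy0 (hb4.trans (mul_le_mul_of_nonneg_left hyb2 hc.le))) hN
  rw [← mul_assoc, hlead] at hlow hup
  have hq := Real.exp_pos (-x)
  have hER : E * R ≤ 1 := mul_le_one₀ hE1 hR0 hR1
  have hpq : N * snTail l y ≤ rexp (-x) := by
    refine hup.trans ?_
    have h1 : (0 : ℝ) ≤ 1 / c / y ^ 2 := by positivity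
    calc rexp (-x) * (E * R) * (1 - 1 / c / y ^ 2) ≤ rexp (-x) * (E * R) * 1 := by
          gcongr; linarith
      _ ≤ rexp (-x) * 1 * 1 := by gcongr
      _ = rexp (-x) := by ring
  have hprod : 1 - (x ^ 2 / (2 * c * b ^ 2) + 2 * (x / (c * b ^ 2)) + K / b ^ 2) ≤
      E * R * (1 - K / y ^ 2) := by
    have h1 : E + R - 1 ≤ E * R := by
      linarith [mul_nonneg (sub_nonneg.2 hE1) (sub_nonneg.2 hR1)]
    have h2 : E * R - K / b ^ 2 ≤ E * R * (1 - K / y ^ 2) := by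
      have h3 : 0 ≤ K / y ^ 2 := by positivity
      linarith [mul_le_mul_of_nonneg_right hER h3]
    linarith
  have h0 : 0 ≤ N * snTail l y := mul_nonneg hN (snTail_nonneg l y)
  refine (abs_exp_neg_sub_exp_neg_le h0 hq.le).trans ?_
  rw [neg_zero, Real.exp_zero, one_mul, abs_sub_comm, abs_of_nonneg (sub_nonneg.2 hpq)]
  have h1 := mul_le_mul_of_nonneg_left hprod hq.le
  have h2 : rexp (-x) - N * snTail l y ≤
      ((x ^ 2 * rexp (-x)) / (2 * c) + 2 * (x * rexp (-x)) / c + K * rexp (-x)) / b ^ 2 := by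
    have : ((x ^ 2 * rexp (-x)) / (2 * c) + 2 * (x * rexp (-x)) / c + K * rexp (-x)) / b ^ 2 =
      rexp (-x) * (x ^ 2 / (2 * c * b ^ 2) + 2 * (x / (c * b ^ 2)) + K / b ^ 2) := by
      field_simp
    rw [this]
    linarith
  refine h2.trans ?_
  have h3 : rexp (-x) ≤ 1 := Real.exp_le_one_iff.2 (neg_nonpos.2 hx)
  calc ((x ^ 2 * rexp (-x)) / (2 * c) + 2 * (x * rexp (-x)) / c + K * rexp (-x)) / b ^ 2
      ≤ (2 / (2 * c) + 2 * 1 / c + K * 1) / b ^ 2 := by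
        gcongr
        · exact sq_mul_exp_neg_le_two hx
        · exact mul_exp_neg_le_one x
    _ = (3 / c + K) / b ^ 2 := by
        field_simp
        ring

/-- Bounds for `N * snTail` on the moderate part of the lower half line. -/
theorem IsNorming.mul_snTail_bounds {l N b z : ℝ} (h : IsNorming l N b) (hl : l < 0)
    (hb16 : 16 ≤ (1 + l ^ 2) * b ^ 2) (hbK : 8 * (2 / (1 + l ^ 2) + 1 / l ^ 2) ≤ b ^ 2)
    (hz : 0 ≤ z) (hzb : z ≤ (1 + l ^ 2) * b ^ 2 / 2) :
    rexp (3 * z / 4) / 2 ≤ N * snTail l (((1 + l ^ 2) * b)⁻¹ * (-z) + b) ∧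
    |N * snTail l (((1 + l ^ 2) * b)⁻¹ * (-z) + b) - rexp z| ≤
      rexp z * ((8 * z / (1 + l ^ 2) + z ^ 2 / (2 * (1 + l ^ 2)) +
        4 * (2 / (1 + l ^ 2) + 1 / l ^ 2)) / b ^ 2) := by
  have hlead := h.mul_snTailLead hl (-z)
  have hN : 0 ≤ N := by rw [← h.2]; positivity
  have hb := h.1
  have hl0 : l ≠ 0 := hl.ne
  have hc : 0 < 1 + l ^ 2 := by positivity
  set c := 1 + l ^ 2
  set K := 2 / c + 1 / l ^ 2 with hK
  have hK0 : 0 < K := by positivity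
  have hcb : 0 < c * b ^ 2 := by positivity
  obtain ⟨s, hs⟩ : ∃ s, s = z / (c * b ^ 2) := ⟨_, rfl⟩
  have hs0 : 0 ≤ s := by rw [hs]; positivity
  have hs2 : s ≤ 1 / 2 := by
    rw [hs, div_le_iff₀ hcb]
    linarith
  have hyeq : (c * b)⁻¹ * (-z) + b = b * (1 - s) := by
    rw [hs]
    field_simp
    ring
  have hs1 : 0 < 1 - s := by linarith
  rw [hyeq] at hlead ⊢
  rw [neg_neg, neg_sq, mul_comm b, div_mul_cancel_right₀ hb.ne'] at hlead
  set y := b * (1 - s) with hy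
  have hy' : (1 - s) * b = y := mul_comm _ _
  rw [hy'] at hlead
  have hy0 : 0 < y := by positivity
  have hyb2 : b ^ 2 / 4 ≤ y ^ 2 := by
    rw [hy, mul_pow]
    have : 1 / 4 ≤ (1 - s) ^ 2 := by linarith [sq_nonneg (1 / 2 - s)]
    linarith [mul_le_mul_of_nonneg_left this (sq_nonneg b)]
  have hsz : z ^ 2 / (2 * c * b ^ 2) = s * z / 2 := by
    rw [hs]
    field_simp
  rw [hsz] at hlead
  set E := rexp (-(s * z / 2)) with hE
  have hsz0 : 0 ≤ s * z := mul_nonneg hs0 hz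
  have hE1 : E ≤ 1 := Real.exp_le_one_iff.2 (by linarith)
  have hE2 : 1 - s * z / 2 ≤ E := Real.one_sub_le_exp_neg _
  have hE3 : rexp (-(z / 4)) ≤ E :=
    Real.exp_le_exp.2 (by linarith [mul_le_mul_of_nonneg_right hs2 hz])
  have hE0 : 0 < E := Real.exp_pos _
  set R := ((1 - s)⁻¹) ^ 2 with hR
  have hR1 : 1 ≤ R := one_le_pow₀ ((one_le_inv₀ hs1).2 (by linarith))
  have hR2 : R ≤ 1 + 8 * s := by
    rw [hR, inv_pow, inv_le_iff_one_le_mul₀ (by positivity)]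
    linarith [mul_nonneg hs0 (sub_nonneg.2 hs2), mul_nonneg hs0 (sq_nonneg (1 / 2 - s))]
  have hKy : K / y ^ 2 ≤ 4 * K / b ^ 2 := by
    rw [div_le_div_iff₀ (by positivity) (by positivity)]
    linarith [mul_le_mul_of_nonneg_left hyb2 hK0.le]
  have hKb : 4 * K / b ^ 2 ≤ 1 / 2 := by
    rw [div_le_iff₀ (by positivity)]
    linarith
  have hlow := mul_le_mul_of_nonneg_left (le_snTail hl hy0) hN
  have hup := mul_le_mul_of_nonneg_left (snTail_le hl hy0
    (by linarith [mul_le_mul_of_nonneg_left hyb2 hc.le])) hN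
  rw [← mul_assoc, hlead] at hlow hup
  have hq := Real.exp_pos z
  have hlow2 : rexp z * E * (1 - 4 * K / b ^ 2) ≤ N * snTail l y := by
    refine le_trans ?_ hlow
    rw [← mul_assoc]
    calc rexp z * E * (1 - 4 * K / b ^ 2) ≤ rexp z * E * (1 - K / y ^ 2) := by gcongr
      _ ≤ rexp z * E * R * (1 - K / y ^ 2) := by
        refine mul_le_mul_of_nonneg_right (le_mul_of_one_le_right (by positivity) hR1) ?_
        linarith
  have hKb0 : 0 ≤ 4 * K / b ^ 2 := by positivity
  refine ⟨?_, abs_sub_le_iff.2 ⟨?_, ?_⟩⟩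
  · refine le_trans ?_ hlow2
    have : rexp (3 * z / 4) = rexp z * rexp (-(z / 4)) := by
      rw [← Real.exp_add]
      congr 1
      ring
    rw [this, div_eq_mul_one_div]
    gcongr
    linarith
  · have h1 : N * snTail l y ≤ rexp z * (1 + 8 * s) := by
      refine hup.trans ?_
      have h1 : (0 : ℝ) ≤ 1 / c / y ^ 2 := by positivity
      calc rexp z * (E * R) * (1 - 1 / c / y ^ 2) ≤ rexp z * (E * R) * 1 := by
            gcongr; linarith
        _ ≤ rexp z * (1 * (1 + 8 * s)) * 1 := by gcongr
        _ = rexp z * (1 + 8 * s) := by ring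
    have h2 : 8 * s ≤ (8 * z / c + z ^ 2 / (2 * c) + 4 * K) / b ^ 2 := by
      have h3 : 8 * s = 8 * z / c / b ^ 2 := by
        rw [hs]
        field_simp
      rw [h3]
      gcongr
      have : 0 ≤ z ^ 2 / (2 * c) := by positivity
      linarith
    have h3 := mul_le_mul_of_nonneg_left h2 hq.le
    linarith
  · have h2 : s * z / 2 + 4 * K / b ^ 2 ≤ (8 * z / c + z ^ 2 / (2 * c) + 4 * K) / b ^ 2 := by
      have h3 : s * z / 2 + 4 * K / b ^ 2 = (z ^ 2 / (2 * c) + 4 * K) / b ^ 2 := by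
        rw [hs]
        field_simp
      rw [h3]
      gcongr
      have : 0 ≤ 8 * z / c := by positivity
      linarith
    have h3 : 1 - (s * z / 2 + 4 * K / b ^ 2) ≤ E * (1 - 4 * K / b ^ 2) := by
      linarith [mul_nonneg hKb0 (sub_nonneg.2 hE1)]
    have h4 := mul_le_mul_of_nonneg_left h3 hq.le
    have h5 := mul_le_mul_of_nonneg_left h2 hq.le
    linarith

theorem exp_neg_half_exp_le (z : ℝ) : rexp (-(rexp (3 * z / 4) / 2)) ≤ 48 * rexp (-(9 * z / 4)) := by
  set w := rexp (3 * z / 4) / 2 with hw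
  have hw0 : 0 < w := by positivity
  have h1 := Real.pow_div_factorial_le_exp w hw0.le 3
  have h2 : w ^ 3 = rexp (9 * z / 4) / 8 := by
    rw [hw, div_pow, ← Real.exp_nat_mul]
    norm_num
    ring
  rw [h2] at h1
  norm_num [Nat.factorial] at h1
  rw [Real.exp_neg, Real.exp_neg, ← div_eq_mul_inv, inv_le_iff_one_le_mul₀ (by positivity),
    div_mul_eq_mul_div, le_div_iff₀ (by positivity)]
  linarith

theorem IsNorming.abs_sub_le_of_neg {l N b z : ℝ} (h : IsNorming l N b) (hl : l < 0)
    (hb16 : 16 ≤ (1 + l ^ 2) * b ^ 2) (hbK : 8 * (2 / (1 + l ^ 2) + 1 / l ^ 2) ≤ b ^ 2)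
    (hz : 0 ≤ z) (hzb : z ≤ (1 + l ^ 2) * b ^ 2 / 2) :
    |rexp (-(N * snTail l (((1 + l ^ 2) * b)⁻¹ * (-z) + b))) - rexp (-rexp z)| ≤
      48 * (9 / (1 + l ^ 2) + 4 * (2 / (1 + l ^ 2) + 1 / l ^ 2)) / b ^ 2 := by
  obtain ⟨h1, h2⟩ := h.mul_snTail_bounds hl hb16 hbK hz hzb
  have hb := h.1
  have hl0 : l ≠ 0 := hl.ne
  have hc : 0 < 1 + l ^ 2 := by positivity
  set c := 1 + l ^ 2
  set K := 2 / c + 1 / l ^ 2 with hK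
  have hK0 : 0 < K := by positivity
  have h3 : rexp (3 * z / 4) / 2 ≤ rexp z := by
    have : rexp (3 * z / 4) ≤ rexp z := Real.exp_le_exp.2 (by linarith)
    linarith [Real.exp_pos (3 * z / 4)]
  have h4 : 48 * rexp (-(9 * z / 4)) * rexp z ≤ 48 * rexp (-z) := by
    rw [mul_assoc, ← Real.exp_add]
    gcongr
    linarith
  have h5 : rexp (-z) ≤ 1 := Real.exp_le_one_iff.2 (neg_nonpos.2 hz)
  calc _ ≤ rexp (-(rexp (3 * z / 4) / 2)) *
        |N * snTail l ((c * b)⁻¹ * (-z) + b) - rexp z| := abs_exp_neg_sub_exp_neg_le h1 h3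
    _ ≤ 48 * rexp (-(9 * z / 4)) *
        (rexp z * ((8 * z / c + z ^ 2 / (2 * c) + 4 * K) / b ^ 2)) := by
      gcongr
      exact exp_neg_half_exp_le z
    _ ≤ 48 * rexp (-z) * ((8 * z / c + z ^ 2 / (2 * c) + 4 * K) / b ^ 2) := by
      rw [← mul_assoc]
      gcongr
    _ = 48 * (8 * (z * rexp (-z)) / c + (z ^ 2 * rexp (-z)) / (2 * c) + 4 * K * rexp (-z)) /
        b ^ 2 := by
      field_simp
    _ ≤ 48 * (8 * 1 / c + 2 / (2 * c) + 4 * K * 1) / b ^ 2 := by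
      gcongr
      · exact mul_exp_neg_le_one z
      · exact sq_mul_exp_neg_le_two hz
    _ = _ := by
      field_simp
      ring

theorem IsNorming.abs_sub_le_of_lt {l N b z : ℝ} (h : IsNorming l N b) (hl : l < 0)
    (hb16 : 16 ≤ (1 + l ^ 2) * b ^ 2) (hbK : 8 * (2 / (1 + l ^ 2) + 1 / l ^ 2) ≤ b ^ 2)
    (hzb : (1 + l ^ 2) * b ^ 2 / 2 ≤ z) :
    |rexp (-(N * snTail l (((1 + l ^ 2) * b)⁻¹ * (-z) + b))) - rexp (-rexp z)| ≤
      16 / (3 * (1 + l ^ 2)) / b ^ 2 := by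
  have hb := h.1
  have hN : 0 ≤ N := by rw [← h.2]; positivity
  have hc : 0 < 1 + l ^ 2 := by positivity
  have h1 := (h.mul_snTail_bounds hl hb16 hbK (by positivity) le_rfl).1
  set c := 1 + l ^ 2
  set w := 3 * (c * b ^ 2) / 16 with hw
  have hw0 : 0 < w := by positivity
  have h2 : w ≤ rexp (3 * (c * b ^ 2 / 2) / 4) / 2 := by
    have := Real.add_one_le_exp (3 * (c * b ^ 2 / 2) / 4)
    linarith
  have h3 : snTail l ((c * b)⁻¹ * (-(c * b ^ 2 / 2)) + b) ≤ snTail l ((c * b)⁻¹ * (-z) + b) :=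
    antitone_snTail l (by gcongr)
  have h4 : w ≤ N * snTail l ((c * b)⁻¹ * (-z) + b) :=
    (h2.trans h1).trans (mul_le_mul_of_nonneg_left h3 hN)
  have h5 : w ≤ rexp z := by
    have := Real.add_one_le_exp z
    linarith
  have h6 : rexp (-w) ≤ 16 / (3 * c) / b ^ 2 := by
    have h7 := mul_exp_neg_le_one w
    have h8 : 16 / (3 * c) / b ^ 2 = 1 / w := by
      rw [hw]
      field_simp
    rw [h8, le_div_iff₀ hw0]
    linarith
  have h7 : rexp (-(N * snTail l ((c * b)⁻¹ * (-z) + b))) ≤ rexp (-w) :=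
    Real.exp_le_exp.2 (neg_le_neg h4)
  have h8 : rexp (-rexp z) ≤ rexp (-w) := Real.exp_le_exp.2 (neg_le_neg h5)
  rw [abs_sub_le_iff]
  constructor
  · linarith [Real.exp_pos (-rexp z)]
  · linarith [Real.exp_pos (-(N * snTail l ((c * b)⁻¹ * (-z) + b)))]

theorem IsNorming.abs_exp_sub_gumbel_le {l N b : ℝ} (h : IsNorming l N b) (hl : l < 0)
    (hb16 : 16 ≤ (1 + l ^ 2) * b ^ 2) (hbK : 8 * (2 / (1 + l ^ 2) + 1 / l ^ 2) ≤ b ^ 2) (x : ℝ) :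
    |rexp (-(N * snTail l (((1 + l ^ 2) * b)⁻¹ * x + b))) - rexp (-rexp (-x))| ≤
      48 * (9 / (1 + l ^ 2) + 4 * (2 / (1 + l ^ 2) + 1 / l ^ 2)) / b ^ 2 := by
  have hl0 : l ≠ 0 := hl.ne
  have hc : 0 < (1 + l ^ 2)⁻¹ := by positivity
  have hK : 0 < 2 / (1 + l ^ 2) + 1 / l ^ 2 := by positivity
  rcases le_total 0 x with hx | hx
  · refine (h.abs_sub_le_of_nonneg hl (by linarith) (by linarith) hx).trans ?_
    gcongr
    rw [div_eq_mul_inv 3, div_eq_mul_inv 9]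
    linarith
  · obtain ⟨z, rfl⟩ : ∃ z, x = -z := ⟨-x, (neg_neg x).symm⟩
    rw [neg_neg]
    rcases le_total z ((1 + l ^ 2) * b ^ 2 / 2) with hz | hz
    · exact h.abs_sub_le_of_neg hl hb16 hbK (by linarith) hz
    · refine (h.abs_sub_le_of_lt hl hb16 hbK hz).trans ?_
      gcongr
      rw [div_eq_mul_inv 9, div_mul_eq_div_div, div_eq_mul_inv _ (1 + l ^ 2)]
      linarith

/-- At the origin the powers exceed the Gumbel value by a multiple of `b⁻²`. -/
theorem IsNorming.le_exp_sub_gumbel_zero {l N b : ℝ} (h : IsNorming l N b) (hl : l < 0)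
    (hb4 : 4 ≤ (1 + l ^ 2) * b ^ 2) :
    1 / (4 * (1 + l ^ 2) * b ^ 2) ≤ rexp (-(N * snTail l b)) - rexp (-1) := by
  have hb := h.1
  have hN : 0 ≤ N := by rw [← h.2]; positivity
  have hc : 0 < 1 + l ^ 2 := by positivity
  have hlead : N * snTailLead l b = 1 := by
    have := h.mul_snTailLead hl 0
    simpa [hb.ne'] using this
  have hup := mul_le_mul_of_nonneg_left (snTail_le hl hb hb4) hN
  rw [← mul_assoc, hlead, one_mul] at hup
  set c := 1 + l ^ 2
  have h1 : rexp (-1) * (1 + 1 / c / b ^ 2) ≤ rexp (-(N * snTail l b)) := by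
    have h2 := Real.add_one_le_exp (1 / c / b ^ 2)
    calc rexp (-1) * (1 + 1 / c / b ^ 2) ≤ rexp (-1) * rexp (1 / c / b ^ 2) := by
          gcongr; linarith
      _ = rexp (-1 + 1 / c / b ^ 2) := (Real.exp_add _ _).symm
      _ ≤ _ := Real.exp_le_exp.2 (by linarith)
  have h2 : 1 / 4 ≤ rexp (-1) := by
    rw [Real.exp_neg, one_div]
    exact inv_anti₀ (Real.exp_pos 1) (Real.exp_one_lt_three.le.trans (by norm_num))
  have h3 : 1 / (4 * c * b ^ 2) = 1 / 4 * (1 / c / b ^ 2) := by field_simp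
  have h4 : 0 ≤ 1 / c / b ^ 2 := by positivity
  rw [h3]
  nlinarith

theorem IsNorming.six_div_le {l N b : ℝ} (h : IsNorming l N b) (hl : l < 0)
    (hb : 96 / (π * |l| * (1 + l ^ 2)) ≤ b ^ 2) : 6 / N ≤ 1 / (8 * (1 + l ^ 2) * b ^ 2) := by
  obtain ⟨hb0, rfl⟩ := h
  have hm : 0 < |l| := abs_pos.2 hl.ne
  have hc : 0 < 1 + l ^ 2 := by positivity
  rw [div_le_iff₀ (by positivity)] at hb
  have h1 := Real.add_one_le_exp ((1 + l ^ 2) * b ^ 2 / 2)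
  set P := π * |l| * (1 + l ^ 2) with hP
  have hP0 : 0 < P := by positivity
  rw [div_le_div_iff₀ (by positivity) (by positivity)]
  have h2 : P * b ^ 2 * ((1 + l ^ 2) * b ^ 2 / 2) ≤
      P * b ^ 2 * rexp ((1 + l ^ 2) * b ^ 2 / 2) := by
    gcongr
    linarith
  have h3 : 96 * ((1 + l ^ 2) * b ^ 2 / 2) ≤ b ^ 2 * P * ((1 + l ^ 2) * b ^ 2 / 2) := by gcongr
  linarith

theorem IsNorming.log_bounds {l N b : ℝ} (h : IsNorming l N b) (hl : l < 0)
    (hb : 1 / (π * |l| * (1 + l ^ 2)) ≤ b ^ 2) :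
    (1 + l ^ 2) / 2 * b ^ 2 ≤ Real.log N ∧
      Real.log N ≤ (π * |l| * (1 + l ^ 2) + (1 + l ^ 2) / 2) * b ^ 2 := by
  obtain ⟨hb0, rfl⟩ := h
  have hm : 0 < |l| := abs_pos.2 hl.ne
  have hc : 0 < 1 + l ^ 2 := by positivity
  rw [div_le_iff₀ (by positivity)] at hb
  set P := π * |l| * (1 + l ^ 2) with hP
  have hP0 : 0 < P := by positivity
  rw [Real.log_mul (by positivity) (Real.exp_pos _).ne', Real.log_exp]
  have h1 : 0 ≤ Real.log (P * b ^ 2) := Real.log_nonneg (by linarith)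
  have h2 := Real.log_le_sub_one_of_pos (x := P * b ^ 2) (by positivity)
  constructor <;> linarith

theorem IsNorming.lt_sq {l N b B : ℝ} (h : IsNorming l N b) (hB : 0 ≤ B)
    (hN : π * |l| * (1 + l ^ 2) * B * rexp ((1 + l ^ 2) * B / 2) < N) : B < b ^ 2 := by
  by_contra! hle
  refine hN.not_ge ?_
  rw [← h.2]
  have hc : 0 < 1 + l ^ 2 := by positivity
  gcongr

theorem stmt_12 (l : ℝ) (hl : l < 0) (b : ℕ → ℝ)
    (hb : ∀ n : ℕ, 1 ≤ n → 0 < b n ∧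
      Real.pi * |l| * (1 + l ^ 2) * (b n) ^ 2 * Real.exp ((1 + l ^ 2) * (b n) ^ 2 / 2) = n) :
    ∃ C₁ > 0, ∃ C₂ > 0, ∃ n₀ : ℕ, ∀ n : ℕ, n₀ ≤ n →
      C₁ / Real.log n <
        (⨆ x : ℝ, |(snCdf l (((1 + l ^ 2) * b n)⁻¹ * x + b n)) ^ n - Real.exp (-Real.exp (-x))|) ∧
      (⨆ x : ℝ, |(snCdf l (((1 + l ^ 2) * b n)⁻¹ * x + b n)) ^ n - Real.exp (-Real.exp (-x))|) <
        C₂ / Real.log n := by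
  have hl0 : l ≠ 0 := hl.ne
  have hm : 0 < |l| := abs_pos.2 hl0
  have hc : 0 < 1 + l ^ 2 := by positivity
  have hc1 : 1 ≤ 1 + l ^ 2 := by linarith [sq_nonneg l]
  obtain ⟨K, hK⟩ : ∃ K, K = 2 / (1 + l ^ 2) + 1 / l ^ 2 := ⟨_, rfl⟩
  have hK0 : 0 < K := by rw [hK]; positivity
  obtain ⟨P, hP⟩ : ∃ P, P = π * |l| * (1 + l ^ 2) := ⟨_, rfl⟩
  have hP0 : 0 < P := by rw [hP]; positivity
  obtain ⟨M, hM⟩ : ∃ M, M = 48 * (9 / (1 + l ^ 2) + 4 * K) := ⟨_, rfl⟩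
  have hM0 : 0 < M := by rw [hM]; positivity
  obtain ⟨B, hB⟩ : ∃ B, B = 16 + 8 * K + 96 / P := ⟨_, rfl⟩
  have hPi : 0 < 1 / P := by positivity
  have hP96 : 96 / P = 96 * (1 / P) := by ring
  have hB0 : 0 ≤ B := by rw [hB]; positivity
  obtain ⟨n₁, hn₁⟩ := exists_nat_gt (P * B * rexp ((1 + l ^ 2) * B / 2))
  refine ⟨1 / 32, by norm_num, (M + 1) * (P + (1 + l ^ 2) / 2) + 1, by positivity, n₁ + 1,
    fun n hn => ?_⟩
  have hn1 : 1 ≤ n := by omega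
  have hnorm : IsNorming l n (b n) := hb n hn1
  have hbn := hnorm.1
  have hBb : B < b n ^ 2 := hnorm.lt_sq hB0 (by
    rw [← hP]
    exact hn₁.trans_le (by exact_mod_cast (Nat.le_succ _).trans hn))
  have hb16 : 16 ≤ (1 + l ^ 2) * b n ^ 2 := by nlinarith
  have hbK : 8 * (2 / (1 + l ^ 2) + 1 / l ^ 2) ≤ b n ^ 2 := by rw [← hK]; linarith
  have h6 := hnorm.six_div_le hl (by rw [← hP]; linarith)
  obtain ⟨hlog1, hlog2⟩ := hnorm.log_bounds hl (by rw [← hP]; linarith)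
  rw [← hP] at hlog2
  have hb2 : 0 < b n ^ 2 := by positivity
  have hlog : 0 < Real.log n := lt_of_lt_of_le (by positivity) hlog1
  have hpow : ∀ y, |snCdf l y ^ n - rexp (-(n * snTail l y))| ≤ 6 / n := fun y => by
    rw [snCdf_eq]
    exact abs_one_sub_pow_sub_exp_le (snTail_nonneg l y) (snTail_le_one l y) hn1
  have hpt : ∀ x : ℝ, |(snCdf l (((1 + l ^ 2) * b n)⁻¹ * x + b n)) ^ n - rexp (-rexp (-x))| ≤
      (M + 1) / b n ^ 2 := fun x => by
    have h1 := hnorm.abs_exp_sub_gumbel_le hl hb16 hbK x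
    rw [← hK, ← hM] at h1
    have h2 : 1 / (8 * (1 + l ^ 2) * b n ^ 2) ≤ 1 / b n ^ 2 := by
      gcongr
      nlinarith
    refine (abs_sub_le _ _ _).trans ((add_le_add (hpow _) h1).trans ?_)
    rw [add_div]
    linarith
  constructor
  · refine lt_of_lt_of_le ?_ (le_ciSup ⟨_, Set.forall_mem_range.2 hpt⟩ 0)
    simp only [mul_zero, zero_add, neg_zero, Real.exp_zero]
    have h1 := hnorm.le_exp_sub_gumbel_zero hl (by linarith)
    have h2 := (abs_sub_le_iff.1 (hpow (b n))).2
    have h3 : 1 / (8 * (1 + l ^ 2) * b n ^ 2) ≤ snCdf l (b n) ^ n - rexp (-1) := by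
      have : 1 / (4 * (1 + l ^ 2) * b n ^ 2) = 2 * (1 / (8 * (1 + l ^ 2) * b n ^ 2)) := by
        field_simp
        norm_num
      linarith
    refine lt_of_lt_of_le ?_ (h3.trans (le_abs_self _))
    rw [div_lt_div_iff₀ hlog (by positivity)]
    linarith
  · refine lt_of_le_of_lt (ciSup_le hpt) ?_
    rw [div_lt_div_iff₀ hb2 hlog]
    have := mul_le_mul_of_nonneg_left hlog2 (by positivity : 0 ≤ M + 1)
    linarith
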